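/- In a link-irregular graph, any two vertices of degree n-1 (where n is the number of vertices) would have identical neighborhoods up to the other vertex; hence a link-irregular graph on n vertices has at most one vertex of degree n-1. -/

import Mathlib

open SimpleGraph Finset

/-- The link of a vertex `v`: the subgraph induced by the neighborhood of `v`. -/
def SimpleGraph.link {V : Type*} (G : SimpleGraph V) (v : V) :
    SimpleGraph (G.neighborSet v) :=
  G.induce (G.neighborSet v)

/-- A graph is link-irregular if the links of any two distinct vertices are
non-isomorphic. -/
def SimpleGraph.LinkIrregular {V : Type*} (G : SimpleGraph V) : Prop :=
  ∀ u v : V, u ≠ v → ¬ Nonempty (G.link u ≃g G.link v)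

/-- A graph isomorphism restricts to an isomorphism between the links of corresponding vertices. -/
def SimpleGraph.Iso.mapLink {V W : Type*} {G : SimpleGraph V} {H : SimpleGraph W} (φ : G ≃g H)
    (v : V) : G.link v ≃g H.link (φ v) where
  toEquiv := φ.mapNeighborSet v
  map_rel_iff' := φ.map_adj_iff

/-- Swapping two universal vertices is an automorphism. -/
def SimpleGraph.IsUniversal.swapIso {V : Type*} [DecidableEq V] {G : SimpleGraph V} {u v : V}
    (hu : G.IsUniversal u) (hv : G.IsUniversal v) : G ≃g G where
  toEquiv := Equiv.swap u v
  map_rel_iff' := by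
    intro a b
    have hu_adj (w : V) : G.Adj u w ↔ u ≠ w := ⟨Adj.ne, fun h => hu h⟩
    have hv_adj (w : V) : G.Adj v w ↔ v ≠ w := ⟨Adj.ne, fun h => hv h⟩
    grind [SimpleGraph.adj_comm]

/-- A link-irregular graph has at most one universal vertex. -/
theorem SimpleGraph.LinkIrregular.eq_of_isUniversal {V : Type*} {G : SimpleGraph V}
    (h : G.LinkIrregular) {u v : V} (hu : G.IsUniversal u) (hv : G.IsUniversal v) : u = v := by
  classical
  by_contra huv
  have e := (hu.swapIso hv).mapLink u
  rw [show hu.swapIso hv u = v from Equiv.swap_apply_left u v] at e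
  exact h u v huv ⟨e⟩

/-- A link-irregular graph on `n` vertices has at most one vertex of degree
`n - 1`. -/
theorem linkIrregular_at_most_one_max_degree {V : Type*} [Fintype V]
    (G : SimpleGraph V) [DecidableRel G.Adj] (h : G.LinkIrregular) :
    (Finset.univ.filter fun v => G.degree v + 1 = Fintype.card V).card ≤ 1 := by
  have isUniversal {w : V} (hw : G.degree w + 1 = Fintype.card V) : G.IsUniversal w :=
    (G.degree_eq_card_sub_one w).mp (by omega)
  rw [Finset.card_le_one]
  intro u hu v hv
  exact h.eq_of_isUniversal (isUniversal (Finset.mem_filter.mp hu).2)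
    (isUniversal (Finset.mem_filter.mp hv).2)
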